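/- arXiv:2512.11100 — 2 statements merged into one kernel-verified Lean document; each statement's English description precedes it below -/
import Mathlib

section
/- Let a > 0 and let (τ_x)_{x≥1} be a sequence of positive integers with τ_x/√x → a as x → ∞. Then the absorption probabilities of the absorbed walk converge: lim_{x→∞} P(0|τ_x, x) = 1 − erf(a/(2√(pq))), where erf(z) = (2/√π)∫_0^z e^{−t²} dt. -/
namespace RW

/-- Free random walk: `Pfree α β τ x y` is the probability that a walk started at `τ`,
making steps `+1`, `-1` (probability `α` each) and `0` (probability `β`), is at `y`
after `x` time steps. -/
noncomputable def Pfree (α β : ℝ) (τ : ℤ) : ℕ → ℤ → ℝ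
  | 0, y => if y = τ then 1 else 0
  | x + 1, y => α * Pfree α β τ x (y - 1) + α * Pfree α β τ x (y + 1) + β * Pfree α β τ x y

/-- Absorbed random walk: `Pabs α β τ x y` is the probability that the walk started at
`τ ≥ 1`, with an absorbing wall at height `0`, is at `y` after `x` time steps (being at `0`
means having been absorbed before or at time `x`). -/
noncomputable def Pabs (α β : ℝ) (τ : ℕ) : ℕ → ℕ → ℝ
  | 0, y => if y = τ then 1 else 0
  | x + 1, 0 => α * Pabs α β τ x 1 + Pabs α β τ x 0
  | x + 1, 1 => α * Pabs α β τ x 2 + β * Pabs α β τ x 1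
  | x + 1, (y + 2) =>
      α * Pabs α β τ x (y + 1) + α * Pabs α β τ x (y + 3) + β * Pabs α β τ x (y + 2)

/-- The error function `erf z = (2/√π) ∫_0^z e^(-t²) dt`. -/
noncomputable def erf (z : ℝ) : ℝ :=
  2 / Real.sqrt Real.pi * ∫ t in (0:ℝ)..z, Real.exp (-t ^ 2)


open MeasureTheory ProbabilityTheory Filter Topology
open scoped NNReal

/-- A solution of the free recurrence started from the Heaviside function is symmetric. -/
lemma cdf_add_cdf_neg {α : ℝ} {F : ℕ → ℤ → ℝ}
    (h0 : ∀ k, F 0 k = if 0 ≤ k then 1 else 0)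
    (hs : ∀ x k, F (x + 1) k =
      α * F x (k - 1) + α * F x (k + 1) + (1 - 2 * α) * F x k) (x : ℕ) (k : ℤ) :
    F x k + F x (-k - 1) = 1 := by
  induction x generalizing k with
  | zero =>
    rw [h0, h0]
    split_ifs <;> first | omega | norm_num
  | succ x ih =>
    have h1 := ih (k - 1)
    have h2 := ih (k + 1)
    have h3 := ih k
    rw [show -(k - 1) - 1 = -k - 1 + 1 by ring] at h1
    rw [show -(k + 1) - 1 = -k - 1 - 1 by ring] at h2
    rw [hs, hs]
    linear_combination α * h1 + α * h2 + (1 - 2 * α) * h3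

/-- Reflection principle at positive heights, in terms of the distribution function `F`
of the free walk. -/
lemma Pabs_succ_eq {α : ℝ} {F : ℕ → ℤ → ℝ}
    (h0 : ∀ k, F 0 k = if 0 ≤ k then 1 else 0)
    (hs : ∀ x k, F (x + 1) k =
      α * F x (k - 1) + α * F x (k + 1) + (1 - 2 * α) * F x k)
    {τ : ℕ} (hτ : 1 ≤ τ) (x y : ℕ) :
    Pabs α (1 - 2 * α) τ x (y + 1) =
      (F x (y + 1 - τ) - F x (y - τ)) - (F x (y + 1 + τ) - F x (y + τ)) := by
  induction x generalizing y with
  | zero =>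
    simp only [Pabs, h0]
    split_ifs <;> first | omega | norm_num
  | succ x ih =>
    rcases y with _ | y
    · have i0 := ih 0
      have i1 := ih 1
      have s1 := cdf_add_cdf_neg h0 hs x (-τ)
      have s2 := cdf_add_cdf_neg h0 hs x (-τ - 1)
      simp only [Pabs, zero_add, Nat.reduceAdd, hs] at i0 i1 ⊢
      rw [i0, i1]
      push_cast at *
      ring_nf at s1 s2 ⊢
      linear_combination α * (s2 - s1)
    · have i0 := ih y
      have i1 := ih (y + 1)
      have i2 := ih (y + 2)
      simp only [Pabs, hs]
      rw [show y + 3 = y + 2 + 1 by rfl, show y + 2 = y + 1 + 1 by rfl, i0, i1, i2]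
      push_cast
      ring_nf

/-- Reflection principle for the absorption probability. -/
lemma Pabs_zero_eq {α : ℝ} {F : ℕ → ℤ → ℝ}
    (h0 : ∀ k, F 0 k = if 0 ≤ k then 1 else 0)
    (hs : ∀ x k, F (x + 1) k =
      α * F x (k - 1) + α * F x (k + 1) + (1 - 2 * α) * F x k)
    {τ : ℕ} (hτ : 1 ≤ τ) (x : ℕ) :
    Pabs α (1 - 2 * α) τ x 0 = F x (-τ) + F x (-(τ + 1)) := by
  induction x with
  | zero =>
    simp only [Pabs, h0]
    split_ifs <;> first | omega | norm_num
  | succ x ih =>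
    have i0 := Pabs_succ_eq h0 hs hτ x 0
    have s1 := cdf_add_cdf_neg h0 hs x τ
    have s2 := cdf_add_cdf_neg h0 hs x (τ + 1)
    simp only [Pabs, zero_add] at i0 ⊢
    rw [i0, ih, hs, hs]
    push_cast
    ring_nf at s1 s2 ⊢
    linear_combination α * (s1 - s2)

/-- Law of one step of the free walk. -/
noncomputable def stepLaw (α : ℝ) : Measure ℝ :=
  ENNReal.ofReal α • Measure.dirac 1 + ENNReal.ofReal α • Measure.dirac (-1) +
    ENNReal.ofReal (1 - 2 * α) • Measure.dirac 0

lemma isProbabilityMeasure_stepLaw {α : ℝ} (h : 0 ≤ α) (h' : 0 ≤ 1 - 2 * α) :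
    IsProbabilityMeasure (stepLaw α) where
  measure_univ := by
    simp only [stepLaw, Measure.coe_add, Measure.coe_smul, Pi.add_apply, Pi.smul_apply,
      measure_univ, smul_eq_mul, mul_one]
    rw [← ENNReal.ofReal_add h h, ← ENNReal.ofReal_add (by linarith) h',
      ← ENNReal.ofReal_one]
    congr 1
    ring

lemma integral_stepLaw {α : ℝ} (h : 0 ≤ α) (h' : 0 ≤ 1 - 2 * α) (f : ℝ → ℝ) :
    ∫ z, f z ∂(stepLaw α) = α * f 1 + α * f (-1) + (1 - 2 * α) * f 0 := by
  have hd (c : ℝ) (y : ℝ) : Integrable f (ENNReal.ofReal c • Measure.dirac y) :=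
    (integrable_dirac (by simp)).smul_measure ENNReal.ofReal_ne_top
  rw [stepLaw, integral_add_measure ((hd _ _).add_measure (hd _ _)) (hd _ _),
    integral_add_measure (hd _ _) (hd _ _)]
  simp [integral_smul_measure, h, h']

lemma variance_stepLaw {α : ℝ} (h : 0 ≤ α) (h' : 0 ≤ 1 - 2 * α) :
    Var[id; stepLaw α] = 2 * α := by
  rw [variance_eq_integral aemeasurable_id, integral_stepLaw h h', integral_stepLaw h h']
  simp
  ring

/-- Distribution function of the sum of a random variable and an independent step. -/
lemma measureReal_add_step_le {Ω : Type*} [MeasurableSpace Ω] {P : Measure Ω}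
    [IsProbabilityMeasure P] {α : ℝ} (h : 0 ≤ α) (h' : 0 ≤ 1 - 2 * α) {S X : Ω → ℝ}
    (hS : Measurable S) (hX : Measurable X) (hXlaw : HasLaw X (stepLaw α) P)
    (hind : IndepFun S X P) (t : ℝ) :
    P.real {ω | S ω + X ω ≤ t} = α * P.real {ω | S ω ≤ t - 1} + α * P.real {ω | S ω ≤ t + 1} +
      (1 - 2 * α) * P.real {ω | S ω ≤ t} := by
  have := isProbabilityMeasure_stepLaw h h'
  have := Measure.isProbabilityMeasure_map (μ := P) hS.aemeasurable
  have hmap := hind.symm.map_add_eq_map_conv_map hX hS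
  rw [hXlaw.map_eq] at hmap
  have e1 : P.real {ω | S ω + X ω ≤ t} = (P.map (X + S)).real (Set.Iic t) := by
    rw [map_measureReal_apply (by fun_prop) measurableSet_Iic]
    simp only [Set.preimage, Set.mem_Iic, Pi.add_apply, add_comm]
  have hconv (y : ℝ) : (P.map S).map (fun z ↦ y + z) (Set.Iic t) = P {ω | S ω ≤ t - y} := by
    rw [Measure.map_map (by fun_prop) hS, Measure.map_apply (by fun_prop) measurableSet_Iic]
    congr 1
    ext ω
    simp [le_sub_iff_add_le']
  rw [e1, hmap, stepLaw, Measure.add_conv, Measure.add_conv, Measure.conv_smul_left,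
    Measure.conv_smul_left, Measure.conv_smul_left, Measure.dirac_conv, Measure.dirac_conv,
    Measure.dirac_conv]
  simp only [Measure.real, Measure.coe_add, Measure.coe_smul, Pi.add_apply, Pi.smul_apply, hconv,
    smul_eq_mul]
  rw [ENNReal.toReal_add (by finiteness) (by finiteness),
    ENNReal.toReal_add (by finiteness) (by finiteness)]
  simp [ENNReal.toReal_mul, h, h']

/-- Lower tail of a centered Gaussian in terms of the error function. -/
lemma two_mul_gaussianReal_real_Iic {v : ℝ≥0} (hv : v ≠ 0) {a : ℝ} (ha : 0 ≤ a) :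
    2 * (gaussianReal 0 v).real (Set.Iic (-a)) = 1 - erf (a / √(2 * v)) := by
  have hv0 : (0 : ℝ) < v := by positivity
  set c : ℝ := √(2 * v) with hc
  have hc0 : 0 < c := by positivity
  have hc2 : c ^ 2 = 2 * v := Real.sq_sqrt (by positivity)
  have hsq : √(2 * Real.pi * v) = c * √Real.pi := by
    rw [hc, ← Real.sqrt_mul (by positivity)]
    congr 1
    ring
  have hpi : 0 < √Real.pi := by positivity
  have hexp (x : ℝ) : gaussianPDFReal 0 v x = (c * √Real.pi)⁻¹ * Real.exp (-(x / c) ^ 2) := by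
    rw [gaussianPDFReal, hsq, div_pow, hc2, sub_zero, neg_div]
  have hint := integrable_gaussianPDFReal 0 v
  have htail (b : ℝ) : ∫ x in Set.Iic (-b), gaussianPDFReal 0 v x =
      ∫ x in Set.Ioi b, gaussianPDFReal 0 v x := by
    rw [← neg_neg b, ← integral_comp_neg_Iic, neg_neg]
    simp [hexp, neg_div]
  have hhalf : 2 * ∫ x in Set.Ioi 0, gaussianPDFReal 0 v x = 1 := by
    rw [← integral_gaussianPDFReal_eq_one 0 hv, ← intervalIntegral.integral_Iic_add_Ioi
      hint.integrableOn hint.integrableOn (b := 0), ← htail 0, neg_zero]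
    ring
  have hsub := intervalIntegral.integral_Ioi_sub_Ioi hint.integrableOn ha
  have hscale : ∫ x in (0 : ℝ)..a, gaussianPDFReal 0 v x =
      (√Real.pi)⁻¹ * ∫ t in (0 : ℝ)..a / c, Real.exp (-t ^ 2) := by
    simp_rw [hexp]
    rw [intervalIntegral.integral_const_mul,
      intervalIntegral.integral_comp_div (fun t ↦ Real.exp (-t ^ 2)) hc0.ne', zero_div, smul_eq_mul]
    field_simp
  rw [Measure.real, gaussianReal_apply_eq_integral 0 hv, ENNReal.toReal_ofReal
    (integral_nonneg fun x ↦ gaussianPDFReal_nonneg 0 v x), htail, erf]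
  rw [hscale] at hsub
  linear_combination hhalf - 2 * hsub

/-- Central limit theorem for distribution functions at varying thresholds. -/
lemma tendsto_measureReal_sum_le {Ω : Type*} [MeasurableSpace Ω] {P : Measure Ω}
    [IsProbabilityMeasure P] {X : ℕ → Ω → ℝ} (hX : MemLp (X 0) 2 P) (hmean : P[X 0] = 0)
    (hvar : Var[X 0; P] ≠ 0) (hindep : iIndepFun X P)
    (hident : ∀ i, IdentDistrib (X i) (X 0) P P) {c : ℕ → ℝ} {a : ℝ}
    (hc : Tendsto (fun n ↦ c n / √n) atTop (𝓝 a)) :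
    Tendsto (fun n ↦ P.real {ω | ∑ i ∈ Finset.range n, X i ω ≤ -c n}) atTop
      (𝓝 ((gaussianReal 0 Var[X 0; P].toNNReal).real (Set.Iic (-a)))) := by
  set v := Var[X 0; P].toNNReal with hv
  have hv0 : v ≠ 0 := by
    rw [hv, ne_eq, Real.toNNReal_eq_zero, not_le]
    exact (variance_nonneg _ _).lt_of_ne' hvar
  have clt := tendstoInDistribution_inv_sqrt_mul_sum_sub (HasLaw.id (μ := gaussianReal 0 v))
    hX hindep hident
  have hcm : TendstoInMeasure P (fun n (_ : Ω) ↦ c n / √n) atTop (fun _ ↦ a) :=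
    tendstoInMeasure_of_tendsto_ae (fun n ↦ by fun_prop) (ae_of_all _ fun _ ↦ hc)
  have hsum := (clt.add_of_tendstoInMeasure_const hcm (fun n ↦ by fun_prop)).tendsto
  have hnull : ((gaussianReal 0 v).map (fun z ↦ id z + a)) (frontier (Set.Iic 0)) = 0 := by
    have := nullSingletonClass_gaussianReal (μ := 0 + a) hv0
    simp only [id_eq, gaussianReal_map_add_const, frontier_Iic, measure_singleton]
  have key := ProbabilityMeasure.tendsto_measure_of_null_frontier_of_tendsto' hsum hnull
  have hlimit : ((gaussianReal 0 v).map (fun z ↦ id z + a)) (Set.Iic 0) =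
      gaussianReal 0 v (Set.Iic (-a)) := by
    rw [Measure.map_apply (by fun_prop) measurableSet_Iic]
    congr 1
    ext z
    simp [le_neg_iff_add_nonpos_right]
  simp only [ProbabilityMeasure.coe_mk, hlimit] at key
  have key := (ENNReal.tendsto_toReal (measure_ne_top _ _)).comp key
  refine key.congr' ?_
  filter_upwards [eventually_gt_atTop 0] with n hn
  have hn' : (0 : ℝ) < √n := by positivity
  simp only [Function.comp_apply, Measure.real]
  rw [Measure.map_apply_of_aemeasurable _ measurableSet_Iic]
  · congr 2
    ext ω
    simp only [hmean, mul_zero, sub_zero, Set.mem_preimage, Pi.add_apply, Set.mem_Iic,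
      Set.mem_ofPred_eq]
    rw [inv_mul_eq_div, ← add_div, div_le_iff₀ hn', zero_mul, le_neg_iff_add_nonpos_right]
  · have := fun i ↦ (hident i).aemeasurable_fst
    exact (clt.forall_aemeasurable n).add (by fun_prop)

/-- Gaussian limit of the absorption probability. If `τ_x/√x → a > 0` then
`P(0|τ_x,x) → 1 - erf(a/(2√(pq)))` (the variance per step of the free walk being `2pq`). -/
theorem absorption_probability_gaussian_limit
    (p q : ℝ) (hp : 0 < p) (hq : 0 < q) (hpq : p + q = 1)
    (a : ℝ) (ha : 0 < a) (τ : ℕ → ℕ) (hτpos : ∀ x, 1 ≤ τ x)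
    (hlim : Filter.Tendsto (fun x : ℕ => (τ x : ℝ) / Real.sqrt x)
      Filter.atTop (nhds a)) :
    Filter.Tendsto (fun x : ℕ => Pabs (p * q) (1 - 2 * (p * q)) (τ x) x 0)
      Filter.atTop (nhds (1 - erf (a / (2 * Real.sqrt (p * q))))) := by
  have hα : 0 < p * q := mul_pos hp hq
  have hβ : 0 ≤ 1 - 2 * (p * q) := by nlinarith [sq_nonneg (p - q)]
  generalize p * q = α at *
  have := isProbabilityMeasure_stepLaw hα.le hβ
  obtain ⟨Ω, _, P, X, hXm, hXlaw, hindep, _⟩ := exists_iid ℕ (stepLaw α)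
  have hident (i : ℕ) : IdentDistrib (X i) (X 0) P P := (hXlaw i).identDistrib (hXlaw 0)
  have hmean : P[X 0] = 0 := by
    rw [(hXlaw 0).integral_eq, integral_stepLaw hα.le hβ]
    simp
  have hvar : Var[X 0; P] = 2 * α := by
    rw [(hXlaw 0).variance_eq, variance_stepLaw hα.le hβ]
  have hL2 : MemLp (X 0) 2 P :=
    memLp_two_of_variance_ne_zero (hXm 0).aestronglyMeasurable (by rw [hvar]; positivity)
  set F : ℕ → ℤ → ℝ := fun x k ↦ P.real {ω | ∑ i ∈ Finset.range x, X i ω ≤ k} with hF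
  have h0 (k : ℤ) : F 0 k = if 0 ≤ k then 1 else 0 := by
    by_cases hk : 0 ≤ k <;> simp [hF, hk]
  have hs (x : ℕ) (k : ℤ) : F (x + 1) k =
      α * F x (k - 1) + α * F x (k + 1) + (1 - 2 * α) * F x k := by
    have hS : Measurable (∑ i ∈ Finset.range x, X i) := by fun_prop
    have := measureReal_add_step_le hα.le hβ hS (hXm x) (hXlaw x)
      (hindep.indepFun_sum_range_succ hXm x) k
    simpa [hF, Finset.sum_range_succ] using this
  have hlim' : Tendsto (fun x : ℕ ↦ ((τ x : ℝ) + 1) / √x) atTop (𝓝 a) := by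
    have h1 : Tendsto (fun x : ℕ ↦ 1 / √(x : ℝ)) atTop (𝓝 0) :=
      tendsto_const_nhds.div_atTop (Real.tendsto_sqrt_atTop.comp tendsto_natCast_atTop_atTop)
    simpa [add_div] using hlim.add h1
  have hvar0 : Var[X 0; P] ≠ 0 := by rw [hvar]; positivity
  have l1 := tendsto_measureReal_sum_le hL2 hmean hvar0 hindep hident hlim
  have l2 := tendsto_measureReal_sum_le hL2 hmean hvar0 hindep hident hlim'
  have hg := two_mul_gaussianReal_real_Iic (v := Var[X 0; P].toNNReal)
    (by rw [hvar, ne_eq, Real.toNNReal_eq_zero]; linarith) ha.le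
  have hsqrt : √(2 * (Var[X 0; P].toNNReal : ℝ)) = 2 * √α := by
    rw [hvar, Real.coe_toNNReal _ (by positivity), ← mul_assoc, Real.sqrt_mul (by norm_num),
      Real.sqrt_mul_self (by norm_num)]
  rw [hsqrt] at hg
  have hsum := l1.add l2
  rw [← two_mul, hg] at hsum
  refine hsum.congr fun x ↦ ?_
  rw [Pabs_zero_eq h0 hs (hτpos x)]
  simp [hF]

end RW
end

section
/- Persistence of the local particle filling: in the stationary process of the DSS, for every site x ∈ {1,…,L}, every t ≥ 0 and every τ ≥ 1: if 1 ≤ τ ≤ x−1 then Cov(z(x,t), z(x,t+τ)) = pq · P(0|τ, x−1), and this covariance is strictly positive; if τ ≥ x then Cov(z(x,t), z(x,t+τ)) = 0. -/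
namespace DSS

/-- A state of the DSS on `L` sites: a stable field `z : Fin L → Bool` together with a
finite multiset `w` of waiting particles (particles past site `L` have left the system). -/
structure State (L : ℕ) where
  z : Fin L → Bool
  w : Multiset (Fin L)

variable {L : ℕ}

/-- The multiset holding the right neighbour of `x`; empty if the particle leaves the system. -/
def succSite (L : ℕ) (x : Fin L) : Multiset (Fin L) :=
  if h : x.val + 1 < L then {(⟨x.val + 1, h⟩ : Fin L)} else 0

/-- Evolution of a waiting particle at `x` when `z x = 1`: the waiting particle moves to
`x+1` and the stable particle at `x` becomes a waiting particle at `x`. -/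
def topple (s : State L) (x : Fin L) : State L :=
  ⟨Function.update s.z x false, s.w + succSite L x⟩

/-- Evolution of a waiting particle at `x` when `z x = 0`, settling branch (probability p). -/
def settle (s : State L) (x : Fin L) : State L :=
  ⟨Function.update s.z x true, s.w.erase x⟩

/-- Evolution of a waiting particle at `x` when `z x = 0`, jumping branch (probability q). -/
def jump (s : State L) (x : Fin L) : State L :=
  ⟨s.z, s.w.erase x + succSite L x⟩

/-- `stabilizeAux p q R n s c` is the probability that, evolving one waiting particle at a
time (the particle being selected by the rule `R`), the process started from `s` reaches
within `n` elementary steps a stable state whose stable field is `c`. -/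
noncomputable def stabilizeAux (p q : ℝ) (R : State L → Option (Fin L)) :
    ℕ → State L → (Fin L → Bool) → ℝ
  | 0, s, c => if s.w = 0 ∧ s.z = c then 1 else 0
  | n + 1, s, c =>
    match R s with
    | none => if s.z = c then 1 else 0
    | some x =>
      if s.z x then stabilizeAux p q R n (topple s x) c
      else p * stabilizeAux p q R n (settle s x) c
        + q * stabilizeAux p q R n (jump s x) c

/-- The canonical evolution rule: evolve the leftmost waiting particle. -/
def minRule (s : State L) : Option (Fin L) :=
  if h : s.w = 0 then none
  else some (s.w.toFinset.min'
    (Finset.nonempty_iff_ne_empty.mpr (by simpa [Multiset.toFinset_eq_empty] using h)))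

/-- A termination measure: the stabilization process started from `s` ends after at most
`fuel s` elementary steps, whatever the rule and the randomness. -/
def potential (s : State L) : ℕ :=
  (s.w.map fun x => L + 1 - x.val).sum + ∑ x : Fin L, (if s.z x then L + 1 - x.val else 0)

def fuel (s : State L) : ℕ := 2 * potential s + Multiset.card s.w

/-- Add one waiting particle at site `1` (index `0`). -/
def addGrain (r : Fin L → Bool) : State L :=
  ⟨r, if h : 0 < L then {(⟨0, h⟩ : Fin L)} else 0⟩

/-- The driven-dissipative transition kernel `W` of the DSS: add a particle at site 1 and
stabilize. -/
noncomputable def Wker (p q : ℝ) (r r' : Fin L → Bool) : ℝ :=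
  stabilizeAux p q minRule (fuel (addGrain r)) (addGrain r) r'

/-- `W` as a matrix on stable configurations. -/
noncomputable def Wmat (p q : ℝ) (L : ℕ) :
    Matrix (Fin L → Bool) (Fin L → Bool) ℝ :=
  Matrix.of fun r r' => Wker p q r r'

/-- The product Bernoulli(p) measure `ψ(r) = p^(Σ r) q^(L - Σ r)`. -/
noncomputable def psi (p q : ℝ) {L : ℕ} (r : Fin L → Bool) : ℝ :=
  p ^ (Finset.univ.filter fun x => r x = true).card *
    q ^ (L - (Finset.univ.filter fun x => r x = true).card)


/-- `E[z(x,t)]` in the stationary process. -/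
noncomputable def meanZ (p q : ℝ) (L : ℕ) (t : ℕ) (x : Fin L) : ℝ :=
  ∑ r0 : Fin L → Bool, ∑ r1 : Fin L → Bool,
    psi p q r0 * ((Wmat p q L) ^ t) r0 r1 * (if r1 x then 1 else 0)

/-- `Cov(z(x,t), z(x',t+τ))` in the stationary process. -/
noncomputable def covZ (p q : ℝ) (L : ℕ) (t τ : ℕ) (x x' : Fin L) : ℝ :=
  (∑ r0 : Fin L → Bool, ∑ r1 : Fin L → Bool, ∑ r2 : Fin L → Bool,
      psi p q r0 * ((Wmat p q L) ^ t) r0 r1 * (if r1 x then 1 else 0) *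
        ((Wmat p q L) ^ τ) r1 r2 * (if r2 x' then 1 else 0))
    - meanZ p q L t x * meanZ p q L (t + τ) x'

/-- One-site kernel: a site receiving `n` particles keeps its state if `n = 0`, and is
refreshed to an independent Bernoulli state otherwise. -/
noncomputable def siteKernel (p q : ℝ) (n : ℕ) (a b : Bool) : ℝ :=
  if n = 0 then (if a = b then 1 else 0) else (if b then p else q)

/-- Probability that the stable field `z`, with `w y` waiting particles at each site `y` and
`m` additional waiting particles at the leftmost site, stabilizes to `c`. -/
noncomputable def flowKernel (p q : ℝ) :
    (L : ℕ) → ℕ → (Fin L → ℕ) → (Fin L → Bool) → (Fin L → Bool) → ℝ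
  | 0, _, _, _, _ => 1
  | L + 1, m, w, z, c =>
    siteKernel p q (m + w 0) (z 0) (c 0) *
      flowKernel p q L (m + w 0 + (z 0).toNat - (c 0).toNat)
        (Fin.tail w) (Fin.tail z) (Fin.tail c)

lemma flowKernel_add_left (p q : ℝ) (L m : ℕ) (w : Fin L → ℕ) (z c : Fin L → Bool) :
    flowKernel p q L m (fun y => w y + if y.val = 0 then 1 else 0) z c
      = flowKernel p q L (m + 1) w z c := by
  cases L with
  | zero => rfl
  | succ L =>
    have h : m + (w 0 + 1) = m + 1 + w 0 := by ring
    simp [flowKernel, Fin.tail_def, h]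

lemma flowKernel_topple (p q : ℝ) (L m : ℕ) (w : Fin L → ℕ) (z c : Fin L → Bool)
    (x : Fin L) (hz : z x = true) (hw : 1 ≤ w x) :
    flowKernel p q L m (fun y => w y + if y.val = x.val + 1 then 1 else 0)
        (Function.update z x false) c
      = flowKernel p q L m w z c := by
  induction L generalizing m with
  | zero => exact x.elim0
  | succ L ih =>
    induction x using Fin.cases with
    | zero =>
      have h0 : ¬(m = 0 ∧ w 0 = 0) := by omega
      have ht := flowKernel_add_left p q L (m + w 0 - (c 0).toNat)
        (Fin.tail w) (Fin.tail z) (Fin.tail c)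
      have h1 : m + w 0 + 1 - (c 0).toNat = m + w 0 - (c 0).toNat + 1 := by
        cases c 0 <;> simp; omega
      simp only [Fin.tail_def] at ht
      simp [flowKernel, siteKernel, Fin.tail_def, hz, h0, h1, ht]
    | succ x =>
      have := ih (m + w 0 + (z 0).toNat - (c 0).toNat) (Fin.tail w) (Fin.tail z) (Fin.tail c) x
        hz hw
      simp only [flowKernel, Fin.tail_update_succ, ← this]
      simp [Fin.tail_def, Fin.ext_iff]

lemma flowKernel_settle_or_jump (p q : ℝ) (hpq : p + q = 1) (L m : ℕ) (w : Fin L → ℕ)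
    (z c : Fin L → Bool) (x : Fin L) (hz : z x = false) (hw : 1 ≤ w x) :
    p * flowKernel p q L m (fun y => w y - if y = x then 1 else 0) (Function.update z x true) c
      + q * flowKernel p q L m
        (fun y => (w y - if y = x then 1 else 0) + if y.val = x.val + 1 then 1 else 0) z c
      = flowKernel p q L m w z c := by
  induction L generalizing m with
  | zero => exact x.elim0
  | succ L ih =>
    induction x using Fin.cases with
    | zero =>
      obtain ⟨k, hk⟩ : ∃ k, w 0 = k + 1 := ⟨w 0 - 1, by omega⟩
      have ht := flowKernel_add_left p q L (m + k - (c 0).toNat)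
        (Fin.tail w) (Fin.tail z) (Fin.tail c)
      simp only [Fin.tail_def] at ht
      by_cases hn : m + k = 0
      · obtain ⟨rfl, rfl⟩ : m = 0 ∧ k = 0 := by omega
        cases hc : c 0 <;> simp_all [flowKernel, siteKernel, Fin.tail_def]
      · have h1 : m + k + 1 - (c 0).toNat = m + k - (c 0).toNat + 1 := by
          cases c 0 <;> simp; omega
        have h2 : m + (k + 1) - (c 0).toNat = m + k - (c 0).toNat + 1 := by
          rw [← h1, add_assoc]
        have hn' : ¬(m = 0 ∧ k = 0) := by omega
        simp only [flowKernel, siteKernel, Fin.tail_def]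
        simp [hz, hk, hn', ht, h1, h2]
        split_ifs <;> rw [← add_mul, hpq, one_mul]
    | succ x =>
      have := ih (m + w 0 + (z 0).toNat - (c 0).toNat) (Fin.tail w) (Fin.tail z) (Fin.tail c) x
        hz hw
      simp only [flowKernel, Fin.tail_update_succ, ← this]
      have h0 : (0 : Fin (L + 1)) ≠ x.succ := (Fin.succ_ne_zero x).symm
      simp [Fin.tail_def, h0]
      ring

lemma flowKernel_zero (p q : ℝ) (L : ℕ) (z c : Fin L → Bool) :
    flowKernel p q L 0 (fun _ => 0) z c = if z = c then 1 else 0 := by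
  induction L with
  | zero => simp [flowKernel, Subsingleton.elim z c]
  | succ L ih =>
    have := ih (Fin.tail z) (Fin.tail c)
    simp only [Fin.tail_def] at this
    have hzc : z = c ↔ z 0 = c 0 ∧ (fun i : Fin L => z i.succ) = fun i : Fin L => c i.succ := by
      simp [funext_iff, Fin.forall_fin_succ]
    by_cases h : z 0 = c 0
    · simp only [flowKernel, siteKernel, Fin.tail_def, hzc, h, true_and]
      simp [this]
      congr
    · simp [flowKernel, siteKernel, hzc, h]

lemma count_succSite (x y : Fin L) :
    (succSite L x).count y = if y.val = x.val + 1 then 1 else 0 := by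
  unfold succSite
  split_ifs with h h' h'
  · simp [Fin.ext_iff, h']
  · simp [Fin.ext_iff, h']
  · omega
  · simp

lemma sum_site_update (z : Fin L → Bool) (x : Fin L) (b : Bool) :
    (∑ y, if Function.update z x b y then L + 1 - y.val else 0)
        + (if z x then L + 1 - x.val else 0)
      = (∑ y, if z y then L + 1 - y.val else 0) + if b then L + 1 - x.val else 0 := by
  have h : ∑ y ∈ Finset.univ.erase x, (if Function.update z x b y then L + 1 - y.val else 0)
      = ∑ y ∈ Finset.univ.erase x, if z y then L + 1 - y.val else 0 :=
    Finset.sum_congr rfl fun y hy => by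
      rw [Function.update_of_ne (Finset.ne_of_mem_erase hy)]
  rw [← Finset.add_sum_erase _ _ (Finset.mem_univ x), h,
    ← Finset.add_sum_erase _ (fun y => if z y then L + 1 - y.val else 0) (Finset.mem_univ x),
    Function.update_self]
  ring

lemma fuel_settle_lt (s : State L) (x : Fin L) (hz : s.z x = false) (hw : x ∈ s.w) :
    fuel (settle s x) < fuel s := by
  obtain ⟨w, hw⟩ := Multiset.exists_cons_of_mem hw
  simp only [fuel, potential, settle, hw, Multiset.erase_cons_head, Multiset.map_cons,
    Multiset.sum_cons, Multiset.card_cons]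
  have h3 := sum_site_update s.z x true
  simp only [hz, if_true, Bool.false_eq_true, if_false] at h3
  omega

lemma sum_map_succSite (x : Fin L) :
    ((succSite L x).map fun x => L + 1 - x.val).sum + 1 ≤ L + 1 - x.val := by
  have := x.isLt
  unfold succSite
  split_ifs <;> simp <;> omega

lemma card_succSite_le (x : Fin L) : (succSite L x).card ≤ 1 := by
  unfold succSite
  split_ifs <;> simp

lemma fuel_jump_lt (s : State L) (x : Fin L) (hw : x ∈ s.w) :
    fuel (jump s x) < fuel s := by
  obtain ⟨w, hw⟩ := Multiset.exists_cons_of_mem hw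
  have h1 := sum_map_succSite x
  have h2 := card_succSite_le x
  simp only [fuel, potential, jump, hw, Multiset.erase_cons_head, Multiset.map_cons,
    Multiset.sum_cons, Multiset.card_cons, Multiset.map_add, Multiset.sum_add, Multiset.card_add]
  omega

lemma fuel_topple_lt (s : State L) (x : Fin L) (hz : s.z x = true) :
    fuel (topple s x) < fuel s := by
  have h1 := sum_map_succSite x
  have h2 := card_succSite_le x
  change fuel ⟨Function.update s.z x false, s.w + succSite L x⟩ < fuel s
  simp only [fuel, potential, Multiset.map_add, Multiset.sum_add, Multiset.card_add]
  have h3 := sum_site_update s.z x false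
  simp only [hz, if_true, Bool.false_eq_true, if_false] at h3
  omega

/-- Abelian property: the stabilization probabilities do not depend on the evolution rule. -/
lemma stabilizeAux_eq_flowKernel (p q : ℝ) (hpq : p + q = 1) (R : State L → Option (Fin L))
    (hnone : ∀ s, R s = none → s.w = 0) (hsome : ∀ s x, R s = some x → x ∈ s.w)
    (n : ℕ) (s : State L) (c : Fin L → Bool) (hn : fuel s ≤ n) :
    stabilizeAux p q R n s c = flowKernel p q L 0 (fun y => s.w.count y) s.z c := by
  induction n generalizing s with
  | zero =>
    have h0 : s.w = 0 := by
      rw [← Multiset.card_eq_zero]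
      simp only [fuel] at hn
      omega
    simp [stabilizeAux, h0, flowKernel_zero]
  | succ n ih =>
    rw [stabilizeAux]
    cases hR : R s with
    | none => simp [hnone s hR, flowKernel_zero]
    | some x =>
      have hx := hsome s x hR
      have hc : 1 ≤ s.w.count x := Multiset.one_le_count_iff_mem.2 hx
      have he : ∀ y, (s.w.erase x).count y = s.w.count y - if y = x then 1 else 0 := by
        intro y
        by_cases h : y = x
        · subst h; simp
        · simp [h]
      cases hz : s.z x with
      | true =>
        have := fuel_topple_lt s x hz
        simp only [hz, if_true]
        rw [ih _ (by omega), ← flowKernel_topple p q L 0 _ s.z c x hz hc]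
        simp [topple, count_succSite]
      | false =>
        have h1 := fuel_settle_lt s x hz hx
        have h2 := fuel_jump_lt s x hx
        simp only [hz, Bool.false_eq_true, if_false]
        rw [ih _ (by omega), ih _ (by omega),
          ← flowKernel_settle_or_jump p q hpq L 0 _ s.z c x hz hc]
        simp [settle, jump, count_succSite, he]

/-- Transition kernel for adding `n` particles at the first site and stabilizing. -/
noncomputable def addKernel (p q : ℝ) (L n : ℕ) :
    Matrix (Fin L → Bool) (Fin L → Bool) ℝ :=
  Matrix.of fun r r' => flowKernel p q L n (fun _ => 0) r r'

lemma Wmat_eq_addKernel (p q : ℝ) (hpq : p + q = 1) (L : ℕ) :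
    Wmat p q L = addKernel p q L 1 := by
  ext r r'
  simp only [Wmat, addKernel, Wker, Matrix.of_apply]
  rw [stabilizeAux_eq_flowKernel p q hpq minRule _ _ _ _ _ le_rfl,
    ← flowKernel_add_left p q L 0]
  · congr 1
    funext y
    have h : 0 < L := y.pos
    simp [addGrain, h, Multiset.count_singleton, Fin.ext_iff]
  · intro s hs
    by_contra h
    simp [minRule, h] at hs
  · intro s x hs
    by_cases h : s.w = 0
    · simp [minRule, h] at hs
    · simp only [minRule, h, dite_false, Option.some.injEq] at hs
      rw [← hs, ← Multiset.mem_toFinset]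
      exact Finset.min'_mem _ _

lemma addKernel_cons (p q : ℝ) (L n : ℕ) (a b : Bool) (r r' : Fin L → Bool) :
    addKernel p q (L + 1) n (Fin.cons a r : Fin (L + 1) → Bool) (Fin.cons b r' : Fin (L + 1) → Bool)
      = siteKernel p q n a b * addKernel p q L (n + a.toNat - b.toNat) r r' := by
  simp [addKernel, flowKernel, Fin.tail_def]

lemma sum_fin_succ_bool (L : ℕ) (f : (Fin (L + 1) → Bool) → ℝ) :
    ∑ r, f r = ∑ b : Bool, ∑ r : Fin L → Bool, f (Fin.cons b r : Fin (L + 1) → Bool) := by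
  rw [← (Fin.consEquiv fun _ : Fin (L + 1) => Bool).sum_comp, Fintype.sum_prod_type]
  rfl

lemma sum_addKernel (p q : ℝ) (hpq : p + q = 1) (L n : ℕ) (r : Fin L → Bool) :
    ∑ r', addKernel p q L n r r' = 1 := by
  induction L generalizing n with
  | zero => simp [addKernel, flowKernel]
  | succ L ih =>
    rw [← Fin.cons_self_tail r, sum_fin_succ_bool]
    simp only [addKernel_cons, ← Finset.mul_sum, ih]
    cases r 0 <;> by_cases h : n = 0 <;> simp [siteKernel, h, hpq]

lemma addKernel_mul (p q : ℝ) (hpq : p + q = 1) (L m n : ℕ) :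
    addKernel p q L m * addKernel p q L n = addKernel p q L (m + n) := by
  induction L generalizing m n with
  | zero =>
    ext r r'
    simp [Matrix.mul_apply, addKernel, flowKernel]
  | succ L ih =>
    ext r r'
    rw [Matrix.mul_apply, ← Fin.cons_self_tail r, ← Fin.cons_self_tail r', sum_fin_succ_bool]
    have key : ∀ b : Bool, ∑ s : Fin L → Bool,
        (siteKernel p q m (r 0) b *
          addKernel p q L (m + (r 0).toNat - b.toNat) (Fin.tail r) s) *
        (siteKernel p q n b (r' 0) *
          addKernel p q L (n + b.toNat - (r' 0).toNat) s (Fin.tail r'))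
        = siteKernel p q m (r 0) b * siteKernel p q n b (r' 0) *
          addKernel p q L (m + n + (r 0).toNat - (r' 0).toNat) (Fin.tail r) (Fin.tail r') := by
      intro b
      have hs : ∀ (k : ℕ) (a b : Bool), siteKernel p q k a b ≠ 0 → b.toNat ≤ k + a.toNat := by
        intro k a b h
        by_cases hk : k = 0
        · subst hk
          have : a = b := by
            by_contra hab
            exact h (by simp [siteKernel, hab])
          simp [this]
        · have := b.toNat_le
          omega
      by_cases h1 : siteKernel p q m (r 0) b = 0
      · simp [h1]
      by_cases h2 : siteKernel p q n b (r' 0) = 0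
      · simp [h2]
      have h1' := hs _ _ _ h1
      have h2' := hs _ _ _ h2
      have he : m + n + (r 0).toNat - (r' 0).toNat
          = (m + (r 0).toNat - b.toNat) + (n + b.toNat - (r' 0).toNat) := by omega
      rw [he, ← ih, Matrix.mul_apply, Finset.mul_sum]
      exact Finset.sum_congr rfl fun s _ => by ring
    simp only [addKernel_cons, key, ← Finset.sum_mul]
    congr 1
    by_cases hm : m = 0 <;> by_cases hn : n = 0 <;> cases r 0 <;> cases r' 0 <;>
      simp [siteKernel, hm, hn, ← add_mul, hpq]

lemma addKernel_zero (p q : ℝ) (L : ℕ) : addKernel p q L 0 = 1 := by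
  ext r r'
  simp [addKernel, flowKernel_zero, Matrix.one_apply]

lemma Wmat_pow (p q : ℝ) (hpq : p + q = 1) (L t : ℕ) :
    Wmat p q L ^ t = addKernel p q L t := by
  induction t with
  | zero => rw [pow_zero, addKernel_zero]
  | succ t ih => rw [pow_succ, ih, Wmat_eq_addKernel p q hpq, addKernel_mul p q hpq]

lemma psi_eq_prod (p q : ℝ) (r : Fin L → Bool) :
    psi p q r = ∏ x, if r x then p else q := by
  rw [Finset.prod_ite, Finset.prod_const, Finset.prod_const, psi]
  congr 2
  have := Finset.card_filter_add_card_filter_not (s := (Finset.univ : Finset (Fin L)))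
    (fun x => r x = true)
  simp only [Finset.card_univ, Fintype.card_fin] at this
  omega

lemma psi_cons (p q : ℝ) (L : ℕ) (b : Bool) (r : Fin L → Bool) :
    psi p q (Fin.cons b r : Fin (L + 1) → Bool) = (if b then p else q) * psi p q r := by
  simp [psi_eq_prod, Fin.prod_univ_succ]

lemma sum_psi (p q : ℝ) (hpq : p + q = 1) (L : ℕ) : ∑ r : Fin L → Bool, psi p q r = 1 := by
  induction L with
  | zero => simp [psi_eq_prod]
  | succ L ih =>
    rw [sum_fin_succ_bool]
    simp [psi_cons, ← Finset.mul_sum, ih, hpq]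

/-- The product Bernoulli measure is invariant under the addition kernels. -/
lemma sum_psi_mul_addKernel (p q : ℝ) (hpq : p + q = 1) (L n : ℕ) (r' : Fin L → Bool) :
    ∑ r, psi p q r * addKernel p q L n r r' = psi p q r' := by
  induction L generalizing n with
  | zero => simp [addKernel, flowKernel, psi_eq_prod]
  | succ L ih =>
    rw [← Fin.cons_self_tail r', sum_fin_succ_bool]
    have key : ∀ b : Bool, ∑ r : Fin L → Bool, ((if b then p else q) * psi p q r) *
        (siteKernel p q n b (r' 0) *
          addKernel p q L (n + b.toNat - (r' 0).toNat) r (Fin.tail r'))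
        = (if b then p else q) * siteKernel p q n b (r' 0) * psi p q (Fin.tail r') := by
      intro b
      rw [← ih (n + b.toNat - (r' 0).toNat), Finset.mul_sum]
      exact Finset.sum_congr rfl fun s _ => by ring
    simp only [addKernel_cons, psi_cons, key, ← Finset.sum_mul]
    congr 1
    by_cases hn : n = 0 <;> cases r' 0 <;> simp [siteKernel, hn, ← add_mul, hpq]

lemma sum_psi_mul_site (p q : ℝ) (hpq : p + q = 1) (L : ℕ) (x : Fin L) :
    ∑ r : Fin L → Bool, psi p q r * (if r x then 1 else 0) = p := by
  induction L with
  | zero => exact x.elim0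
  | succ L ih =>
    rw [sum_fin_succ_bool]
    induction x using Fin.cases with
    | zero => simp [psi_cons, ← Finset.mul_sum, sum_psi p q hpq]
    | succ x =>
      simp only [psi_cons, Fin.cons_succ, mul_assoc, ← Finset.mul_sum, ih]
      simp [← add_mul, hpq]

lemma meanZ_eq (p q : ℝ) (hpq : p + q = 1) (L t : ℕ) (x : Fin L) :
    meanZ p q L t x = p := by
  rw [meanZ, Finset.sum_comm]
  simp only [Wmat_pow p q hpq, ← Finset.sum_mul, sum_psi_mul_addKernel p q hpq,
    sum_psi_mul_site p q hpq]

end DSS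

namespace RW

lemma Pabs_zero_start (α β : ℝ) (x y : ℕ) : Pabs α β 0 x y = if y = 0 then 1 else 0 := by
  induction x generalizing y with
  | zero => rfl
  | succ x ih => rcases y with _ | _ | y <;> simp [Pabs, ih]

/-- Backward equation of the absorbed walk, in the starting height. -/
lemma Pabs_backward (α β : ℝ) (τ x y : ℕ) :
    Pabs α β (τ + 1) (x + 1) y
      = α * Pabs α β τ x y + α * Pabs α β (τ + 2) x y + β * Pabs α β (τ + 1) x y := by
  induction x generalizing y with
  | zero =>
    rcases y with _ | _ | y
    · rcases τ with _ | τ <;> simp [Pabs]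
    · rcases τ with _ | _ | τ <;> simp [Pabs]
    · simp only [Pabs]
      split_ifs <;> first | omega | simp
  | succ x ih =>
    rcases y with _ | _ | y
    · conv_lhs => rw [Pabs, ih, ih]
      simp only [Pabs]
      ring
    · conv_lhs => rw [Pabs, ih, ih]
      simp only [Pabs]
      ring
    · conv_lhs => rw [Pabs, ih, ih, ih]
      simp only [Pabs]
      ring

lemma Pabs_nonneg {α β : ℝ} (hα : 0 ≤ α) (hβ : 0 ≤ β) (τ x y : ℕ) : 0 ≤ Pabs α β τ x y := by
  induction x generalizing y with
  | zero => simp only [Pabs]; split_ifs <;> norm_num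
  | succ x ih =>
    have h1 := fun y => mul_nonneg hα (ih y)
    have h2 := fun y => mul_nonneg hβ (ih y)
    rcases y with _ | _ | y
    · exact add_nonneg (h1 1) (ih 0)
    · exact add_nonneg (h1 2) (h2 1)
    · exact add_nonneg (add_nonneg (h1 _) (h1 _)) (h2 _)

lemma Pabs_absorbed_pos {α β : ℝ} (hα : 0 < α) (hβ : 0 ≤ β) (τ x : ℕ) (h : τ ≤ x) :
    0 < Pabs α β τ x 0 := by
  induction τ generalizing x with
  | zero => simp [Pabs_zero_start]
  | succ τ ih =>
    obtain ⟨x, rfl⟩ : ∃ k, x = k + 1 := ⟨x - 1, by omega⟩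
    rw [Pabs_backward]
    have h1 := mul_pos hα (ih x (by omega))
    have h2 := mul_nonneg hα.le (Pabs_nonneg hα.le hβ (τ + 2) x 0)
    have h3 := mul_nonneg hβ (Pabs_nonneg hα.le hβ (τ + 1) x 0)
    linarith

lemma Pabs_absorbed_eq_zero (α β : ℝ) (τ x : ℕ) (h : x < τ) : Pabs α β τ x 0 = 0 := by
  induction x generalizing τ with
  | zero => simp [Pabs, h.ne]
  | succ x ih =>
    obtain ⟨τ, rfl⟩ : ∃ k, τ = k + 1 := ⟨τ - 1, by omega⟩
    rw [Pabs_backward, ih _ (by omega), ih _ (by omega), ih _ (by omega)]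
    ring

end RW

namespace DSS

lemma sum_psi_two_time (p q : ℝ) (hpq : p + q = 1) (L n : ℕ) (x : Fin L) :
    ∑ r : Fin L → Bool, ∑ r' : Fin L → Bool, psi p q r * (if r x then 1 else 0) *
        addKernel p q L n r r' * (if r' x then 1 else 0)
      = p ^ 2 + p * q * RW.Pabs (p * q) (1 - 2 * (p * q)) n (x : ℕ) 0 := by
  induction L generalizing n with
  | zero => exact x.elim0
  | succ L ih =>
    rw [sum_fin_succ_bool]
    simp only [sum_fin_succ_bool, psi_cons, addKernel_cons]
    obtain rfl : q = 1 - p := by linarith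
    induction x using Fin.cases with
    | zero =>
      by_cases hn : n = 0
      · simp [hn, siteKernel, RW.Pabs, ← Finset.mul_sum, sum_addKernel, sum_psi]
        ring
      · simp [hn, siteKernel, RW.Pabs, ← Finset.mul_sum, sum_addKernel, ← Finset.sum_mul, sum_psi,
          Ne.symm hn, pow_two]
    | succ x =>
      have key : ∀ a b : Bool, ∑ r : Fin L → Bool, ∑ r' : Fin L → Bool,
          (if a then p else 1 - p) * psi p (1 - p) r * (if r x then 1 else 0) *
          (siteKernel p (1 - p) n a b *
            addKernel p (1 - p) L (n + a.toNat - b.toNat) r r') * (if r' x then 1 else 0)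
          = (if a then p else 1 - p) * siteKernel p (1 - p) n a b *
            (p ^ 2 + p * (1 - p) * RW.Pabs (p * (1 - p)) (1 - 2 * (p * (1 - p)))
              (n + a.toNat - b.toNat) (x : ℕ) 0) := by
        intro a b
        rw [← ih, Finset.mul_sum]
        refine Finset.sum_congr rfl fun r _ => ?_
        rw [Finset.mul_sum]
        exact Finset.sum_congr rfl fun r' _ => by ring
      simp only [Fin.cons_succ]
      have comm : ∀ f : (Fin L → Bool) → Bool → (Fin L → Bool) → ℝ,
          ∑ r, ∑ b, ∑ r', f r b r' = ∑ b, ∑ r, ∑ r', f r b r' := fun f => Finset.sum_comm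
      simp only [comm, key]
      rcases n with _ | n
      · simp [siteKernel, RW.Pabs_zero_start]
        ring
      · simp [siteKernel, RW.Pabs_backward]
        ring

lemma covZ_eq (p q : ℝ) (hpq : p + q = 1) (L t τ : ℕ) (x : Fin L) :
    covZ p q L t τ x x = p * q * RW.Pabs (p * q) (1 - 2 * (p * q)) τ (x : ℕ) 0 := by
  have h : (∑ r0 : Fin L → Bool, ∑ r1 : Fin L → Bool, ∑ r2 : Fin L → Bool,
      psi p q r0 * ((Wmat p q L) ^ t) r0 r1 * (if r1 x then 1 else 0) *
        ((Wmat p q L) ^ τ) r1 r2 * (if r2 x then 1 else 0))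
      = ∑ r : Fin L → Bool, ∑ r' : Fin L → Bool, psi p q r * (if r x then 1 else 0) *
        addKernel p q L τ r r' * (if r' x then 1 else 0) := by
    rw [Finset.sum_comm]
    refine Finset.sum_congr rfl fun r1 _ => ?_
    rw [Finset.sum_comm]
    refine Finset.sum_congr rfl fun r2 _ => ?_
    simp only [Wmat_pow p q hpq, ← Finset.sum_mul, sum_psi_mul_addKernel p q hpq]
  rw [covZ, h, sum_psi_two_time p q hpq, meanZ_eq p q hpq, meanZ_eq p q hpq]
  ring

/-- persistence of the local particle filling. For a site of the chain with
Lean index `x : Fin L` (paper site `x+1`): if `1 ≤ τ ≤ x` then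
`Cov(z(x,t), z(x,t+τ)) = pq · P(0|τ,x)` and this covariance is strictly positive;
if `τ ≥ x+1` then the covariance vanishes. -/
theorem local_filling_is_persistent
    (L : ℕ) (hL : 0 < L) (p q : ℝ) (hp : 0 < p) (hq : 0 < q) (hpq : p + q = 1)
    (x : Fin L) (t τ : ℕ) (hτ : 1 ≤ τ) :
    (τ ≤ (x : ℕ) →
      covZ p q L t τ x x = p * q * RW.Pabs (p * q) (1 - 2 * (p * q)) τ (x : ℕ) 0 ∧
      0 < covZ p q L t τ x x) ∧
    ((x : ℕ) + 1 ≤ τ → covZ p q L t τ x x = 0) := by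
  rw [covZ_eq p q hpq]
  have hβ : 0 ≤ 1 - 2 * (p * q) := by
    nlinarith [sq_nonneg p, sq_nonneg q]
  refine ⟨fun h => ⟨rfl, ?_⟩, fun h => ?_⟩
  · have := RW.Pabs_absorbed_pos (mul_pos hp hq) hβ τ x h
    positivity
  · rw [RW.Pabs_absorbed_eq_zero _ _ _ _ h, mul_zero]

end DSS
end
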